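/- Let F/K be an extension of analytic fields of residue characteristic zero (char(tilde K) = 0) with topdeg(F/K) finite. Then topdeg(F/K) = Topdeg(F/K), every maximal topgebraically independent subset S ⊆ F and every minimal topgebraically generating subset T ⊆ F has cardinality topdeg(F/K), and any such subset is a topological transcendence basis of F/K. -/

import Mathlib

open Metric

set_option linter.unusedSectionVars false

/-!
Ambient setting: every extension of analytic (complete, non-archimedean, real-valued)
fields `L/K` embeds isometrically into an algebraically closed, complete,
non-archimedean normed field `Ω` (e.g. the completed algebraic closure of `L`).
We therefore formalize analytic fields as closed subfields of such an ambient field `Ω`.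
-/

variable {Ω : Type*} [NormedField Ω] [CompleteSpace Ω] [IsUltrametricDist Ω] [IsAlgClosed Ω]

/-- The completion `hat{K(S)}` of the subfield generated by `K` and `S`, realized inside
the ambient analytic field `Ω` as the topological closure of the generated subfield. -/
noncomputable def hatGen (K : Subfield Ω) (S : Set Ω) : Subfield Ω :=
  (Subfield.closure ((K : Set Ω) ∪ S)).topologicalClosure

/-- `t` is topologically algebraic ("topgebraic") over `K`: it lies in the closure of the
set of elements algebraic over `K`, i.e. in the completed algebraic closure `hat{K^a}`. -/
def IsTopgebraicElem (K : Subfield Ω) (t : Ω) : Prop :=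
  t ∈ closure {x : Ω | IsAlgebraic K x}

/-- `t` is topologically transcendental over `K`. -/
def TopTranscendental (K : Subfield Ω) (t : Ω) : Prop := ¬ IsTopgebraicElem K t

/-- `S` is topgebraically independent over `K`: every `x ∈ S` is topologically
transcendental over `hat{K(S \ {x})}`. -/
def TopgebraicIndep (K : Subfield Ω) (S : Set Ω) : Prop :=
  ∀ x ∈ S, TopTranscendental (hatGen K (S \ {x})) x

/-- `S` topgebraically generates `L` over `K`: the extension `L / hat{K(S)}` is
topgebraic, i.e. `L` is contained in the completed algebraic closure of `hat{K(S)}`. -/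
def TopgebraicallyGenerates (K L : Subfield Ω) (S : Set Ω) : Prop :=
  (L : Set Ω) ⊆ closure {x : Ω | IsAlgebraic (hatGen K S) x}

/-- The topological transcendence degree of `L/K`: the least cardinal bounding the
cardinality of every topgebraically independent subset of `L`. -/
noncomputable def topdeg (K L : Subfield Ω) : Cardinal :=
  ⨆ S : {S : Set Ω // S ⊆ (L : Set Ω) ∧ TopgebraicIndep K S}, Cardinal.mk S.1

/-- The topgebraic generating degree of `L/K`: the least cardinality of a
topgebraically generating subset of `L` over `K`. -/
noncomputable def Topdeg (K L : Subfield Ω) : Cardinal :=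
  ⨅ S : {S : Set Ω // S ⊆ (L : Set Ω) ∧ TopgebraicallyGenerates K L S}, Cardinal.mk S.1

/-- The `K`-radius of `t`: the distance from `t` to the algebraic closure of `K`. -/
noncomputable def rad (K : Subfield Ω) (t : Ω) : ℝ :=
  Metric.infDist t {x : Ω | IsAlgebraic K x}

/-- The `K`-multiradius of an element `t` of `S`. -/
noncomputable def radS (K : Subfield Ω) (S : Set Ω) (t : Ω) : ℝ :=
  rad (hatGen K (S \ {t})) t

lemma mem_hatGen_of_mem {K : Subfield Ω} {S : Set Ω} {c : Ω} (hc : c ∈ K) : c ∈ hatGen K S :=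
  Subfield.le_topologicalClosure _ (Subfield.subset_closure (Or.inl hc))

lemma mem_hatGen_of_mem_set {K : Subfield Ω} {S : Set Ω} {t : Ω} (ht : t ∈ S) : t ∈ hatGen K S :=
  Subfield.le_topologicalClosure _ (Subfield.subset_closure (Or.inr ht))

/-- The residue field of (any analytic subfield of) `Ω` has characteristic zero:
every nonzero natural number is a unit of the ring of integers, i.e. has norm `1`. -/
def ResidueCharZero (Ω : Type*) [NormedField Ω] : Prop :=
  ∀ n : ℕ, n ≠ 0 → ‖(n : Ω)‖ = 1

open Polynomial

/-- The closure in `Ω` of the algebraic closure of a subfield `k`. -/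
noncomputable def topAlgClosure (k : Subfield Ω) : Subfield Ω :=
  (algebraicClosure k Ω).toSubfield.topologicalClosure

lemma coe_topAlgClosure (k : Subfield Ω) :
    (topAlgClosure k : Set Ω) = closure {x : Ω | IsAlgebraic k x} := by
  change closure ((algebraicClosure k Ω : IntermediateField k Ω) : Set Ω) = _
  congr 1
  ext x
  exact mem_algebraicClosure_iff

lemma isClosed_topAlgClosure (k : Subfield Ω) : IsClosed (topAlgClosure k : Set Ω) :=
  Subfield.isClosed_topologicalClosure _

lemma mem_topAlgClosure_of_isAlgebraic {k : Subfield Ω} {x : Ω} (hx : IsAlgebraic k x) :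
    x ∈ topAlgClosure k := by
  rw [← SetLike.mem_coe, coe_topAlgClosure]
  exact subset_closure hx

lemma le_topAlgClosure (k : Subfield Ω) : k ≤ topAlgClosure k := fun x hx =>
  mem_topAlgClosure_of_isAlgebraic (isAlgebraic_algebraMap (⟨x, hx⟩ : k))

lemma IsAlgebraic.of_subfield_le {k l : Subfield Ω} (h : k ≤ l) {x : Ω} (hx : IsAlgebraic k x) :
    IsAlgebraic l x := by
  obtain ⟨p, hp, hpx⟩ := hx
  refine ⟨p.map (Subfield.inclusion h),
    (Polynomial.map_ne_zero_iff (Subfield.inclusion h).injective).2 hp, ?_⟩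
  rw [aeval_def, eval₂_map]
  exact hpx

lemma topAlgClosure_le {k l : Subfield Ω} (hl : IsClosed (l : Set Ω))
    (hla : ∀ x : Ω, IsAlgebraic l x → x ∈ l) (h : k ≤ l) : topAlgClosure k ≤ l :=
  Subfield.topologicalClosure_minimal _
    (fun x hx => hla x ((mem_algebraicClosure_iff.1 hx).of_subfield_le h)) hl

lemma mem_topAlgClosure_of_isAlgebraic_topAlgClosure {k : Subfield Ω} {x : Ω}
    (hx : IsAlgebraic (topAlgClosure k) x) : x ∈ topAlgClosure k := by
  set A := algebraicClosure k Ω with hA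
  have hle : A.toSubfield ≤ topAlgClosure k := Subfield.le_topologicalClosure _
  let i : A →+* topAlgClosure k := Subfield.inclusion hle
  let : Algebra A (topAlgClosure k) := i.toAlgebra
  have hdense : DenseRange (algebraMap A (topAlgClosure k)) := by
    intro z
    have hz : (z : Ω) ∈ closure (A : Set Ω) := z.2
    rw [Metric.mem_closure_iff] at hz ⊢
    intro ε hε
    obtain ⟨b, hb, hzb⟩ := hz ε hε
    exact ⟨i ⟨b, hb⟩, ⟨⟨b, hb⟩, rfl⟩, hzb⟩
  have hinteg : IsIntegral (topAlgClosure k) x := hx.isIntegral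
  set f := minpoly (topAlgClosure k) x with hf
  have hfm : f.Monic := minpoly.monic hinteg
  have hn : f.natDegree ≠ 0 := (minpoly.natDegree_pos hinteg).ne'
  rw [← SetLike.mem_coe, coe_topAlgClosure, Metric.mem_closure_iff]
  intro δ hδ
  have hε : (δ / (max ‖x‖ 1)) ^ f.natDegree / (f.natDegree + 1) > 0 := by positivity
  obtain ⟨g, gmon, gdeg, gcoeff⟩ :=
    exists_monic_and_natDegree_eq_and_norm_map_algebraMap_coeff_sub_lt hdense hfm hε
  obtain ⟨b, hb, hab⟩ := exists_roots_norm_sub_lt_of_norm_coeff_sub_lt (K := Ω) (a := x)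
    (f := f.map (topAlgClosure k).subtype) (g := g.map A.val.toRingHom) hε
    (by rw [eval_map]; exact minpoly.aeval (topAlgClosure k) x)
    (hfm.map _) (gmon.map _) (by rw [natDegree_map, natDegree_map, gdeg])
    (fun n => by
      have := gcoeff n
      rw [coeff_map] at this
      rw [coeff_map, coeff_map]
      exact this)
    (IsAlgClosed.splits _)
  refine ⟨b, ?_, ?_⟩
  · have hbA : IsAlgebraic A b := by
      refine ⟨g, gmon.ne_zero, ?_⟩
      rw [mem_roots (gmon.map _).ne_zero, IsRoot, eval_map] at hb
      exact hb
    exact hbA.restrictScalars k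
  · rw [natDegree_map] at hab
    rw [dist_eq_norm]
    refine hab.trans_eq ?_
    rw [← mul_div_assoc, mul_div_cancel_left₀ _ (by positivity), ← Real.rpow_natCast,
      ← Real.rpow_mul (by positivity), mul_inv_cancel₀ (by exact_mod_cast hn), Real.rpow_one,
      div_mul_cancel₀ _ (by positivity)]

lemma norm_eq_of_minpoly_eq {M : Subfield Ω} (hM : IsClosed (M : Set Ω)) {a b : Ω}
    (ha : IsAlgebraic M a) (h : minpoly M a = minpoly M b) : ‖a‖ = ‖b‖ := by
  have hb : IsAlgebraic M b := by
    have : minpoly M b ≠ 0 := h ▸ minpoly.ne_zero ha.isIntegral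
    exact (not_imp_comm.1 minpoly.eq_zero this).isAlgebraic
  by_cases ht : ∃ x : M, x ≠ 0 ∧ ‖x‖ ≠ 1
  · let : NontriviallyNormedField M := NontriviallyNormedField.ofNormNeOne ht
    have : CompleteSpace M := hM.completeSpace_coe
    let A := algebraicClosure M Ω
    let : NormedAlgebra M A :=
      { (inferInstance : Algebra M A) with
        norm_smul_le := fun r x => by
          rw [Algebra.smul_def]
          exact norm_mul_le _ _ }
    have key : ∀ x : A, ‖(x : Ω)‖ = spectralValue (minpoly M (x : Ω)) := by
      intro x
      have := NormedAlgebra.norm_eq_spectralNorm M x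
      rw [spectralNorm] at this
      rw [← IntermediateField.minpoly_eq x]
      exact this
    have hka := key ⟨a, mem_algebraicClosure_iff.2 ha⟩
    have hkb := key ⟨b, mem_algebraicClosure_iff.2 hb⟩
    exact hka.trans ((congrArg _ h).trans hkb.symm)
  · push Not at ht
    have hle : ∀ x : Ω, IsAlgebraic M x → ‖x‖ ≤ 1 := by
      intro x hx
      by_contra! hx1
      have hinteg := hx.isIntegral
      set p := minpoly M x
      have hp : p.Monic := minpoly.monic hinteg
      have h0 : aeval x p = 0 := minpoly.aeval M x
      rw [aeval_eq_sum_range, Finset.sum_range_succ, hp.coeff_natDegree, one_smul] at h0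
      have h1 : ‖x ^ p.natDegree‖ ≤ ‖x‖ ^ (p.natDegree - 1) := by
        rw [eq_neg_of_add_eq_zero_right h0, norm_neg]
        refine IsUltrametricDist.norm_sum_le_of_forall_le_of_nonneg (by positivity) ?_
        intro i hi
        have hc : ‖((p.coeff i : M) : Ω)‖ ≤ 1 := by
          by_cases hz : p.coeff i = 0
          · simp [hz]
          · exact (ht _ hz).le
        rw [Algebra.smul_def, norm_mul, norm_pow]
        calc _ ≤ 1 * ‖x‖ ^ (p.natDegree - 1) := by
              refine mul_le_mul hc (pow_le_pow_right₀ hx1.le ?_) (by positivity) zero_le_one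
              have := Finset.mem_range.1 hi
              omega
          _ = _ := one_mul _
      rw [norm_pow] at h1
      have : 0 < p.natDegree := minpoly.natDegree_pos hinteg
      exact absurd h1 (not_le.2 (pow_lt_pow_right₀ hx1 (by omega)))
    have heq : ∀ x : Ω, IsAlgebraic M x → x ≠ 0 → ‖x‖ = 1 := by
      intro x hx hx0
      refine le_antisymm (hle x hx) ?_
      have := hle _ hx.inv
      rw [norm_inv] at this
      exact (inv_le_one₀ (norm_pos_iff.2 hx0)).1 this
    have h0 : a = 0 ↔ b = 0 := by
      constructor
      · rintro rfl
        rw [minpoly.zero] at h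
        have := minpoly.aeval M b
        rwa [← h, aeval_X] at this
      · rintro rfl
        rw [minpoly.zero] at h
        have := minpoly.aeval M a
        rwa [h, aeval_X] at this
    by_cases ha0 : a = 0
    · rw [ha0, h0.1 ha0]
    · rw [heq a ha ha0, heq b hb (fun hb0 => ha0 (h0.2 hb0))]

/-- `b` approximates `a` with relative error at most `q`. -/
def RelClose (q : ℝ) (a b : Ω) : Prop := ‖a - b‖ ≤ q * ‖a‖

namespace RelClose

variable {q : ℝ} {a b c d : Ω}

lemma refl (hq : 0 ≤ q) (a : Ω) : RelClose q a a := by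
  rw [RelClose, sub_self, norm_zero]
  positivity

lemma norm_eq (hq1 : q < 1) (h : RelClose q a b) : ‖b‖ = ‖a‖ := by
  by_cases ha : a = 0
  · subst ha
    simp only [RelClose, norm_zero, mul_zero, zero_sub, norm_neg] at h
    rw [norm_zero]
    exact le_antisymm h (norm_nonneg _)
  · have hlt : ‖a - b‖ < ‖a‖ := h.trans_lt (by nlinarith [norm_pos_iff.2 ha])
    refine le_antisymm ?_ ?_
    · have := IsUltrametricDist.norm_add_le_max a (-(a - b))
      rw [norm_neg, max_eq_left hlt.le] at this
      simpa using this
    · by_contra! hba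
      have := IsUltrametricDist.norm_add_le_max (a - b) b
      rw [sub_add_cancel] at this
      exact absurd this (not_le.2 (max_lt hlt hba))

lemma mul (hq1 : q < 1) (h : RelClose q a b) (h' : RelClose q c d) :
    RelClose q (a * c) (b * d) := by
  have e : a * c - b * d = (a - b) * c + b * (c - d) := by ring
  rw [RelClose, e]
  refine (IsUltrametricDist.norm_add_le_max _ _).trans (max_le ?_ ?_)
  · rw [norm_mul, norm_mul, ← mul_assoc]
    exact mul_le_mul_of_nonneg_right h (norm_nonneg _)
  · rw [norm_mul, norm_mul, h.norm_eq hq1]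
    calc ‖a‖ * ‖c - d‖ ≤ ‖a‖ * (q * ‖c‖) := mul_le_mul_of_nonneg_left h' (norm_nonneg _)
      _ = _ := by ring

lemma inv (hq1 : q < 1) (h : RelClose q a b) : RelClose q a⁻¹ b⁻¹ := by
  by_cases ha : a = 0
  · have hb : b = 0 := by rw [← norm_eq_zero, h.norm_eq hq1, ha, norm_zero]
    simp [RelClose, ha, hb]
  · have hb : b ≠ 0 := by rwa [← norm_ne_zero_iff, h.norm_eq hq1, norm_ne_zero_iff]
    have e : a⁻¹ - b⁻¹ = -((a - b) * (a⁻¹ * b⁻¹)) := by field_simp; ring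
    rw [RelClose, e, norm_neg, norm_mul, norm_mul, norm_inv b, h.norm_eq hq1]
    calc ‖a - b‖ * (‖a⁻¹‖ * ‖a‖⁻¹) ≤ (q * ‖a‖) * (‖a⁻¹‖ * ‖a‖⁻¹) :=
          mul_le_mul_of_nonneg_right h (by positivity)
      _ = _ := by
        have := norm_ne_zero_iff.2 ha
        field_simp

lemma pow (hq0 : 0 ≤ q) (hq1 : q < 1) (h : RelClose q a b) (n : ℕ) :
    RelClose q (a ^ n) (b ^ n) := by
  induction n with
  | zero => simpa using refl hq0 1
  | succ n ih => simpa only [pow_succ] using ih.mul hq1 h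

lemma multiset_prod (hq0 : 0 ≤ q) (hq1 : q < 1) {ι : Type*} {f g : ι → Ω} (s : Multiset ι)
    (h : ∀ i ∈ s, RelClose q (f i) (g i)) : RelClose q (s.map f).prod (s.map g).prod := by
  induction s using Multiset.induction_on with
  | empty => simpa using refl hq0 1
  | cons i s ih =>
    simp only [Multiset.map_cons, Multiset.prod_cons]
    exact (h i (Multiset.mem_cons_self _ _)).mul hq1
      (ih fun j hj => h j (Multiset.mem_cons_of_mem hj))

end RelClose

lemma norm_coeff_prod_X_sub_C_mul_pow_le {r : ℝ} (hr : 0 ≤ r) (s : Multiset Ω)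
    (h : ∀ b ∈ s, ‖b‖ ≤ r) (i : ℕ) :
    ‖(s.map fun b => X - C b).prod.coeff i‖ * r ^ i ≤ r ^ s.card := by
  induction s using Multiset.induction_on generalizing i with
  | empty =>
    simp only [Multiset.map_zero, Multiset.prod_zero, Multiset.card_zero, pow_zero, coeff_one]
    split_ifs with hi
    · simp [hi]
    · simp
  | cons b s ih =>
    specialize ih fun c hc => h c (Multiset.mem_cons_of_mem hc)
    have hb := h b (Multiset.mem_cons_self _ _)
    simp only [Multiset.map_cons, Multiset.prod_cons, Multiset.card_cons]
    set p := (s.map fun b => X - C b).prod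
    have hbp : ∀ j, ‖(C b * p).coeff j‖ * r ^ j ≤ r ^ (s.card + 1) := by
      intro j
      rw [coeff_C_mul, norm_mul, mul_assoc, pow_succ']
      exact mul_le_mul hb (ih j) (by positivity) hr
    cases i with
    | zero =>
      have := hbp 0
      rw [sub_mul, coeff_sub, coeff_X_mul_zero, zero_sub, norm_neg]
      exact this
    | succ i =>
      rw [sub_mul, coeff_sub, coeff_X_mul, sub_eq_add_neg]
      have h1 := IsUltrametricDist.norm_add_le_max (p.coeff i) (-(C b * p).coeff (i + 1))
      rw [norm_neg] at h1
      refine (mul_le_mul_of_nonneg_right h1 (by positivity)).trans ?_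
      rw [max_mul_of_nonneg _ _ (by positivity)]
      refine max_le ?_ (hbp _)
      calc ‖p.coeff i‖ * r ^ (i + 1) = (‖p.coeff i‖ * r ^ i) * r := by ring
        _ ≤ r ^ s.card * r := mul_le_mul_of_nonneg_right (ih i) hr
        _ = _ := by ring

/-- If a finite set of points of norm at most `r` has all mutual distances equal to `r`, then a
polynomial of small degree is bounded, for the Gauss norm of radius `r`, by its values there. -/
lemma norm_coeff_mul_pow_le_of_norm_eval_le {r B : ℝ} (hr : 0 < r) (hB : 0 ≤ B) (s : Finset Ω)
    (hs : ∀ b ∈ s, ‖b‖ ≤ r) (hd : ∀ b ∈ s, ∀ c ∈ s, b ≠ c → ‖b - c‖ = r) {g : Polynomial Ω}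
    (hg : g.degree < s.card) (hgB : ∀ b ∈ s, ‖g.eval b‖ ≤ B) (i : ℕ) :
    ‖g.coeff i‖ * r ^ i ≤ B := by
  classical
  have e := Lagrange.eq_interpolate (s := s) (v := id) (Set.injOn_id _) hg
  rw [e, Lagrange.interpolate_apply, finsetSum_coeff]
  have hri : 0 < r ^ i := by positivity
  rw [← le_div_iff₀ hri]
  refine IsUltrametricDist.norm_sum_le_of_forall_le_of_nonneg (by positivity) fun b hb => ?_
  rw [coeff_C_mul, norm_mul, le_div_iff₀ hri, mul_assoc]
  have hbasis : ‖(Lagrange.basis s id b).coeff i‖ * r ^ i ≤ 1 := by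
    have e2 : Lagrange.basis s id b = C (∏ c ∈ s.erase b, (b - c)⁻¹) *
        ((s.erase b).val.map fun c => X - C c).prod := by
      rw [Lagrange.basis, map_prod]
      change _ = _ * ∏ c ∈ s.erase b, (X - C c)
      rw [← Finset.prod_mul_distrib]
      rfl
    have e3 : ‖∏ c ∈ s.erase b, (b - c)⁻¹‖ = (r ^ (s.erase b).card)⁻¹ := by
      rw [norm_prod, Finset.prod_congr rfl (g := fun _ => r⁻¹), Finset.prod_const, inv_pow]
      intro c hc
      rw [norm_inv, hd b hb c (Finset.mem_of_mem_erase hc) (Finset.ne_of_mem_erase hc).symm]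
    rw [e2, coeff_C_mul, norm_mul, e3, mul_assoc]
    have := norm_coeff_prod_X_sub_C_mul_pow_le hr.le (s.erase b).val
      (fun c hc => hs c (Finset.mem_of_mem_erase hc)) i
    calc _ ≤ (r ^ (s.erase b).card)⁻¹ * r ^ (s.erase b).card :=
          mul_le_mul_of_nonneg_left this (by positivity)
      _ = 1 := inv_mul_cancel₀ (by positivity)
  calc _ ≤ B * 1 := mul_le_mul (hgB b hb) hbasis (by positivity) hB
    _ = B := mul_one B

lemma norm_eval_le_of_coeff {p : Polynomial Ω} {B : ℝ} (hB : 0 ≤ B) {w : Ω}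
    (h : ∀ i, ‖p.coeff i‖ * ‖w‖ ^ i ≤ B) : ‖p.eval w‖ ≤ B := by
  rw [eval_eq_sum_range]
  refine IsUltrametricDist.norm_sum_le_of_forall_le_of_nonneg hB fun i _ => ?_
  rw [norm_mul, norm_pow]
  exact h i

lemma norm_eval_derivative_mul_le_of_coeff {p : Polynomial Ω} {B : ℝ} (hB : 0 ≤ B) {w : Ω}
    (hw : w ≠ 0) (h : ∀ i, ‖p.coeff i‖ * ‖w‖ ^ i ≤ B) : ‖p.derivative.eval w‖ * ‖w‖ ≤ B := by
  have hw' : 0 < ‖w‖ := norm_pos_iff.2 hw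
  rw [← le_div_iff₀ hw']
  refine norm_eval_le_of_coeff (by positivity) fun i => ?_
  rw [coeff_derivative, le_div_iff₀ hw', norm_mul]
  have hi : ‖((i : Ω) + 1)‖ ≤ 1 := by
    have := IsUltrametricDist.norm_natCast_le_one Ω (i + 1)
    simpa using this
  calc _ = (‖p.coeff (i + 1)‖ * ‖w‖ ^ (i + 1)) * ‖(i : Ω) + 1‖ := by ring
    _ ≤ B * 1 := mul_le_mul (h _) hi (by positivity) hB
    _ = B := mul_one B

/-- If the roots of a monic polynomial are as far apart as possible, perturbing its coefficients by
a relative error at most `q` perturbs its roots by a relative error at most `q`. -/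
lemma exists_relClose_root {q : ℝ} (hq0 : 0 ≤ q) (hq1 : q < 1) {L : Subfield Ω}
    (hL : ∀ x : Ω, IsAlgebraic L x → x ∈ L) {p : Polynomial Ω} (hp : p.Monic)
    (hpL : ∀ i, ∃ z ∈ L, RelClose q (p.coeff i) z) (hnd : p.roots.Nodup) {w : Ω} (hw : w ≠ 0)
    (hwp : w ∈ p.roots) (hr : ∀ b ∈ p.roots, ‖b‖ = ‖w‖)
    (hd : ∀ b ∈ p.roots, b ≠ w → ‖w - b‖ = ‖w‖) : ∃ z ∈ L, RelClose q w z := by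
  classical
  have hw' : 0 < ‖w‖ := norm_pos_iff.2 hw
  choose a haL ha using hpL
  set n := p.natDegree with hn
  have hps := IsAlgClosed.splits p
  have hcard : p.roots.card = n := hps.natDegree_eq_card_roots.symm
  let g : Polynomial L := ∑ i ∈ Finset.range (n + 1), monomial i ⟨a i, haL i⟩
  set Q : Polynomial Ω := g.map L.subtype with hQ
  have hQc : ∀ i, i ≤ n → Q.coeff i = a i := by
    intro i hi
    rw [hQ, coeff_map, finsetSum_coeff]
    simp only [coeff_monomial]
    rw [Finset.sum_ite_eq', if_pos (Finset.mem_range.2 (by omega))]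
    rfl
  have hQc' : ∀ i, n < i → Q.coeff i = 0 := by
    intro i hi
    rw [hQ, coeff_map, finsetSum_coeff, Finset.sum_eq_zero, map_zero]
    intro j hj
    rw [coeff_monomial, if_neg]
    have := Finset.mem_range.1 hj
    omega
  have hpc : ∀ i, ‖p.coeff i‖ * ‖w‖ ^ i ≤ ‖w‖ ^ n := by
    intro i
    have := norm_coeff_prod_X_sub_C_mul_pow_le hw'.le p.roots (fun b hb => (hr b hb).le) i
    rwa [hcard, ← hps.eq_prod_roots_of_monic hp] at this
  have hR : ∀ i, ‖(p - Q).coeff i‖ * ‖w‖ ^ i ≤ q * ‖w‖ ^ n := by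
    intro i
    rw [coeff_sub]
    by_cases hi : i ≤ n
    · rw [hQc i hi]
      calc _ ≤ (q * ‖p.coeff i‖) * ‖w‖ ^ i :=
            mul_le_mul_of_nonneg_right (ha i) (by positivity)
        _ = q * (‖p.coeff i‖ * ‖w‖ ^ i) := mul_assoc _ _ _
        _ ≤ _ := mul_le_mul_of_nonneg_left (hpc i) hq0
    · rw [hQc' i (by omega), coeff_eq_zero_of_natDegree_lt (by omega), sub_zero, norm_zero, zero_mul]
      positivity
  have hpw : p.eval w = 0 := (mem_roots hp.ne_zero).1 hwp
  have hQw : ‖Q.eval w‖ ≤ q * ‖w‖ ^ n := by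
    have := norm_eval_le_of_coeff (by positivity) hR
    rwa [eval_sub, hpw, zero_sub, norm_neg] at this
  have hdp : ‖p.derivative.eval w‖ * ‖w‖ = ‖w‖ ^ n := by
    rw [hps.eval_root_derivative hp hwp]
    have : ‖((p.roots.erase w).map (w - ·)).prod‖ = ‖w‖ ^ (p.roots.erase w).card := by
      rw [← Multiset.prod_replicate, ← Multiset.map_const', ← coe_nnnorm]
      change NNReal.toRealHom (nnnormHom _) = _
      rw [map_multiset_prod, map_multiset_prod, Multiset.map_map, Multiset.map_map]
      congr 1
      refine Multiset.map_congr rfl fun b hb => ?_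
      have hb' := (Multiset.Nodup.mem_erase_iff hnd).1 hb
      exact hd b hb'.2 hb'.1
    rw [this, ← pow_succ, Multiset.card_erase_add_one hwp, hcard]
  have hdQ : ‖Q.derivative.eval w‖ * ‖w‖ = ‖w‖ ^ n := by
    have h1 := norm_eval_derivative_mul_le_of_coeff (by positivity) hw hR
    rw [derivative_sub, eval_sub, ← hdp, ← mul_assoc] at h1
    have h2 : RelClose q (p.derivative.eval w) (Q.derivative.eval w) :=
      le_of_mul_le_mul_right h1 hw'
    rw [h2.norm_eq hq1, hdp]
  have hQ0 : Q ≠ 0 := by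
    intro h0
    rw [h0, derivative_zero, eval_zero, norm_zero, zero_mul] at hdQ
    exact (pow_pos hw' n).ne hdQ
  have hroots : ∀ b, Q.eval b = 0 → b ∈ L := by
    intro b hb
    refine hL b ⟨g, fun h => hQ0 (by rw [hQ, h, Polynomial.map_zero]), ?_⟩
    rw [hQ, eval_map] at hb
    exact hb
  by_cases hQw0 : Q.eval w = 0
  · exact ⟨w, hroots w hQw0, RelClose.refl hq0 w⟩
  · have hsum := (IsAlgClosed.splits Q).eval_derivative_eq_eval_mul_sum hQw0
    have hne : Q.roots ≠ 0 := by
      intro h0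
      rw [h0, Multiset.map_zero, Multiset.sum_zero, mul_zero] at hsum
      rw [hsum, norm_zero, zero_mul] at hdQ
      exact (pow_pos hw' n).ne hdQ
    obtain ⟨z, hz, hzle⟩ := IsUltrametricDist.exists_norm_multiset_sum_le Q.roots
      (f := fun z => 1 / (w - z))
    specialize hz hne
    have hzr : Q.eval z = 0 := (mem_roots hQ0).1 hz
    have hwz : 0 < ‖w - z‖ := by
      rw [norm_pos_iff, sub_ne_zero]
      rintro rfl
      exact hQw0 hzr
    refine ⟨z, hroots z hzr, ?_⟩
    rw [hsum, norm_mul] at hdQ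
    rw [norm_div, norm_one] at hzle
    have h3 : ‖w‖ ^ n ≤ q * ‖w‖ ^ n * (1 / ‖w - z‖) * ‖w‖ := by
      rw [← hdQ]
      refine mul_le_mul_of_nonneg_right ?_ hw'.le
      rw [hdQ]
      exact mul_le_mul hQw hzle (norm_nonneg _) (by positivity)
    have h4 : ‖w‖ ^ n * ‖w - z‖ ≤ ‖w‖ ^ n * (q * ‖w‖) := by
      calc _ ≤ (q * ‖w‖ ^ n * (1 / ‖w - z‖) * ‖w‖) * ‖w - z‖ :=
            mul_le_mul_of_nonneg_right h3 hwz.le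
        _ = _ := by field_simp
    exact le_of_mul_le_mul_left h4 (by positivity)

open IntermediateField in
lemma norm_aeval_eq_of_mem_aroots {M : Subfield Ω} (hM : IsClosed (M : Set Ω)) {w b : Ω}
    (hw : IsAlgebraic M w) (hb : aeval b (minpoly M w) = 0) (g : Polynomial M) :
    ‖aeval b g‖ = ‖aeval w g‖ := by
  have hinteg := hw.isIntegral
  let pb := adjoin.powerBasis hinteg
  have hpb : pb.gen = AdjoinSimple.gen M w := rfl
  let φ : M⟮w⟯ →ₐ[M] Ω := pb.lift b (by rwa [hpb, minpoly_gen])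
  have h1 : φ (aeval pb.gen g) = aeval b g := by
    rw [← aeval_algHom_apply, PowerBasis.lift_gen]
  have h2 : (M⟮w⟯).val (aeval pb.gen g) = aeval w g := by
    rw [← aeval_algHom_apply, hpb]
    rfl
  rw [← h1, ← h2]
  refine norm_eq_of_minpoly_eq hM ?_ ?_
  · have := adjoin.finiteDimensional hinteg
    rw [isAlgebraic_algHom_iff φ φ.injective]
    exact Algebra.IsAlgebraic.isAlgebraic _
  · rw [minpoly.algHom_eq φ φ.injective, minpoly.algHom_eq _ (M⟮w⟯).val.injective]

/-- Every element of `M` is approximated by an element of `L` with relative error at most `q`. -/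
def RelApprox (q : ℝ) (M L : Subfield Ω) : Prop := ∀ a ∈ M, ∃ z ∈ L, RelClose q a z

open IntermediateField in
lemma RelApprox.adjoin_simple {q : ℝ} (hq0 : 0 ≤ q) (hq1 : q < 1) [CharZero Ω] {M L : Subfield Ω}
    (hM : IsClosed (M : Set Ω)) (hL : ∀ x : Ω, IsAlgebraic L x → x ∈ L) (h : RelApprox q M L)
    {w : Ω} (hw0 : w ≠ 0) (hw : IsAlgebraic M w)
    (hd : ∀ b c : Ω, aeval b (minpoly M w) = 0 → aeval c (minpoly M w) = 0 → b ≠ c →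
      ‖b - c‖ = ‖w‖) : RelApprox q M⟮w⟯.toSubfield L := by
  classical
  have hw' : 0 < ‖w‖ := norm_pos_iff.2 hw0
  have hinteg := hw.isIntegral
  set f := minpoly M w with hf
  have hfm : f.Monic := minpoly.monic hinteg
  set p : Polynomial Ω := f.map M.subtype with hp
  have hpm : p.Monic := hfm.map _
  have hroot : ∀ b, b ∈ p.roots ↔ aeval b f = 0 := by
    intro b
    rw [mem_roots hpm.ne_zero, IsRoot, hp, eval_map]
    rfl
  have hnd : p.roots.Nodup :=
    nodup_roots ((minpoly.irreducible hinteg).separable.map (f := M.subtype))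
  have hwp : w ∈ p.roots := (hroot w).2 (minpoly.aeval M w)
  have hr : ∀ b ∈ p.roots, ‖b‖ = ‖w‖ := by
    intro b hb
    have := norm_aeval_eq_of_mem_aroots hM hw ((hroot b).1 hb) X
    rwa [aeval_X, aeval_X] at this
  obtain ⟨z, hzL, hz⟩ := exists_relClose_root hq0 hq1 hL hpm
    (fun i => h _ (by rw [hp, coeff_map]; exact (f.coeff i).2)) hnd hw0 hwp hr
    (fun b hb hbw => hd w b ((hroot w).1 hwp) ((hroot b).1 hb) hbw.symm)
  intro a ha
  obtain ⟨g₀, hg₀⟩ : ∃ g₀ : Polynomial M, aeval w g₀ = a := by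
    have : a ∈ (M⟮w⟯).toSubalgebra := ha
    rw [adjoin_simple_toSubalgebra_of_isAlgebraic hw, Algebra.adjoin_singleton_eq_range_aeval] at this
    exact this
  set g := g₀ %ₘ f with hg
  have hga : aeval w g = a := by
    rw [hg, aeval_modByMonic_eq_self_of_root (minpoly.aeval M w), hg₀]
  have hcard : p.roots.toFinset.card = f.natDegree := by
    rw [Multiset.toFinset_card_of_nodup hnd, ← (IsAlgClosed.splits p).natDegree_eq_card_roots, hp,
      natDegree_map]
  have hcoeff : ∀ i, ‖((g.coeff i : M) : Ω)‖ * ‖w‖ ^ i ≤ ‖a‖ := by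
    intro i
    have := norm_coeff_mul_pow_le_of_norm_eval_le (g := g.map M.subtype) hw' (norm_nonneg a)
      p.roots.toFinset (fun b hb => (hr b (Multiset.mem_toFinset.1 hb)).le)
      (fun b hb c hc => hd b c ((hroot b).1 (Multiset.mem_toFinset.1 hb))
        ((hroot c).1 (Multiset.mem_toFinset.1 hc)))
      (by
        rw [hcard, degree_map, ← degree_eq_natDegree hfm.ne_zero]
        exact degree_modByMonic_lt _ hfm)
      (fun b hb => by
        have := norm_aeval_eq_of_mem_aroots hM hw ((hroot b).1 (Multiset.mem_toFinset.1 hb)) g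
        rw [hga] at this
        rw [eval_map]
        exact this.le) i
    rwa [coeff_map] at this
  have hap : ∀ i, ∃ y ∈ L, RelClose q ((g.coeff i : M) : Ω) y := fun i => h _ (g.coeff i).2
  choose y hyL hy using hap
  refine ⟨∑ i ∈ Finset.range (g.natDegree + 1), y i * z ^ i,
    sum_mem fun i _ => mul_mem (hyL i) (pow_mem hzL i), ?_⟩
  rw [RelClose]
  have hsum : a = ∑ i ∈ Finset.range (g.natDegree + 1), ((g.coeff i : M) : Ω) * w ^ i := by
    rw [← hga, aeval_eq_sum_range]
    rfl
  have hdiff : a - ∑ i ∈ Finset.range (g.natDegree + 1), y i * z ^ i =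
      ∑ i ∈ Finset.range (g.natDegree + 1), (((g.coeff i : M) : Ω) * w ^ i - y i * z ^ i) := by
    rw [Finset.sum_sub_distrib, ← hsum]
  rw [hdiff]
  refine IsUltrametricDist.norm_sum_le_of_forall_le_of_nonneg (by positivity) fun i _ => ?_
  refine ((hy i).mul hq1 (hz.pow hq0 hq1 i)).trans ?_
  rw [norm_mul, norm_pow]
  exact mul_le_mul_of_nonneg_left (hcoeff i) hq0

lemma ResidueCharZero.charZero (h : ResidueCharZero Ω) : CharZero Ω :=
  charZero_of_inj_zero fun n hn => by
    by_contra h0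
    have := h n h0
    rw [hn, norm_zero] at this
    exact zero_ne_one this

open IntermediateField in
/-- In residue characteristic zero, a proper algebraic extension of a complete field contains an
element whose conjugates are as far apart as possible. -/
lemma exists_conjugates_dist_eq (hres : ResidueCharZero Ω) {M : Subfield Ω}
    (hM : IsClosed (M : Set Ω)) (hex : ∃ w : Ω, IsAlgebraic M w ∧ w ∉ M) :
    ∃ w : Ω, IsAlgebraic M w ∧ w ∉ M ∧ ∀ b c : Ω, aeval b (minpoly M w) = 0 →
      aeval c (minpoly M w) = 0 → b ≠ c → ‖b - c‖ = ‖w‖ := by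
  classical
  have := hres.charZero
  obtain ⟨v, ⟨hv, hvM⟩, hmin⟩ := exists_minimalFor_of_wellFoundedLT
    (fun w : Ω => IsAlgebraic M w ∧ w ∉ M) (fun w => (minpoly M w).natDegree) hex
  have hatom : ∀ u ∈ M⟮v⟯, u ∉ M → M⟮u⟯ = M⟮v⟯ := by
    intro u hu huM
    have hfd := adjoin.finiteDimensional hv.isIntegral
    have hua : IsAlgebraic M u := by
      have := Algebra.IsAlgebraic.isAlgebraic (R := M) (⟨u, hu⟩ : M⟮v⟯)
      exact this.algHom (M⟮v⟯).val
    have hle : M⟮u⟯ ≤ M⟮v⟯ := adjoin_simple_le_iff.2 hu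
    refine eq_of_le_of_finrank_le hle ?_
    rw [adjoin.finrank hv.isIntegral, adjoin.finrank hua.isIntegral]
    by_contra! hlt
    exact absurd (hmin ⟨hua, huM⟩ hlt.le) (not_le.2 hlt)
  have hfv := adjoin.finiteDimensional hv.isIntegral
  let E : IntermediateField M Ω := adjoin M ((minpoly M v).rootSet Ω)
  have hvE : v ∈ E := subset_adjoin _ _
    ((mem_rootSet_of_ne (minpoly.ne_zero hv.isIntegral)).2 (minpoly.aeval M v))
  have hEs : (minpoly M v).IsSplittingField M E :=
    adjoin_rootSet_isSplittingField (IsAlgClosed.splits _)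
  have hEfd : FiniteDimensional M E := IsSplittingField.finiteDimensional E (minpoly M v)
  have hEn : Normal M E := Normal.of_isSplittingField (minpoly M v)
  have hEg : IsGalois M E := ⟨⟩
  have hiso : ∀ (σ : Gal(E/M)) (x : E), ‖((σ x : E) : Ω)‖ = ‖(x : Ω)‖ := by
    intro σ x
    refine (norm_eq_of_minpoly_eq hM ?_ ?_).symm
    · exact (Algebra.IsAlgebraic.isAlgebraic (R := M) x).algHom E.val
    · rw [← IntermediateField.minpoly_eq, ← IntermediateField.minpoly_eq, minpoly.algEquiv_eq]
  let vE : E := ⟨v, hvE⟩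
  set N : ℕ := Fintype.card Gal(E/M) with hN
  have hN0 : N ≠ 0 := Fintype.card_ne_zero
  have hNM : (N : E) ≠ 0 := by exact_mod_cast hN0
  let t : M := Algebra.trace M E vE / N
  obtain ⟨wE, hwE⟩ : ∃ x : E, x = vE - algebraMap M E t := ⟨_, rfl⟩
  have htr : ∑ σ : Gal(E/M), σ wE = 0 := by
    have : ∀ σ : Gal(E/M), σ wE = σ vE - algebraMap M E t := fun σ => by
      rw [hwE, map_sub, AlgEquiv.commutes]
    rw [Finset.sum_congr rfl fun σ _ => this σ, Finset.sum_sub_distrib,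
      ← trace_eq_sum_automorphisms, Finset.sum_const, Finset.card_univ, nsmul_eq_mul, map_div₀,
      map_natCast, mul_div_cancel₀ _ hNM, sub_self]
  let w : Ω := wE
  have hwv : w = v - t := congrArg (fun x : E => (x : Ω)) hwE
  have hwM : w ∉ M := fun h => hvM (by
    rw [show v = w + t by rw [hwv, sub_add_cancel]]
    exact add_mem h t.2)
  have hw0 : w ≠ 0 := fun h => hwM (h ▸ zero_mem M)
  have hw' : 0 < ‖w‖ := norm_pos_iff.2 hw0
  have hwN : M⟮w⟯ = M⟮v⟯ := by
    refine hatom w ?_ hwM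
    rw [hwv]
    exact sub_mem (mem_adjoin_simple_self M v) ((M⟮v⟯).algebraMap_mem t)
  have hwa : IsAlgebraic M w := (Algebra.IsAlgebraic.isAlgebraic (R := M) wE).algHom E.val
  let H : Subgroup Gal(E/M) :=
    { carrier := {σ | ‖((σ wE : E) : Ω) - w‖ < ‖w‖}
      one_mem' := by
        change ‖w - w‖ < ‖w‖
        rwa [sub_self, norm_zero]
      mul_mem' := by
        intro σ τ hσ hτ
        have e : (((σ * τ) wE : E) : Ω) - w = ((σ (τ wE - wE) : E) : Ω) + ((σ wE : E) - w) := by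
          rw [map_sub, AlgEquiv.mul_apply]
          push_cast
          ring
        change ‖(((σ * τ) wE : E) : Ω) - w‖ < ‖w‖
        rw [e]
        refine (IsUltrametricDist.norm_add_le_max _ _).trans_lt (max_lt ?_ hσ)
        rw [hiso]
        exact hτ
      inv_mem' := by
        intro σ hσ
        change ‖((σ⁻¹ wE : E) : Ω) - w‖ < ‖w‖
        rw [show ((σ⁻¹ wE : E) : Ω) - w = ((σ⁻¹ wE - wE : E) : Ω) by push_cast; rfl,
          ← hiso σ, map_sub, ← AlgEquiv.mul_apply, mul_inv_cancel, AlgEquiv.one_apply]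
        change ‖((σ wE : E) : Ω) - w‖ < ‖w‖ at hσ
        rw [norm_sub_rev] at hσ
        exact hσ }
  have hHmem : ∀ σ, σ ∈ H ↔ ‖((σ wE : E) : Ω) - w‖ < ‖w‖ := fun σ => Iff.rfl
  have hH : ∀ σ ∈ H, σ wE = wE := by
    by_cases hbot : fixedField H = ⊥
    · exfalso
      have htop : ∀ σ, σ ∈ H := by
        intro σ
        rw [← fixingSubgroup_fixedField H, hbot, fixingSubgroup_bot]
        trivial
      have hsum : (N : Ω) * w = -∑ σ : Gal(E/M), (((σ wE : E) : Ω) - w) := by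
        have := congrArg (fun x : E => (x : Ω)) htr
        push_cast at this
        rw [Finset.sum_sub_distrib, this, Finset.sum_const, Finset.card_univ, nsmul_eq_mul]
        ring
      have hnorm : ‖(N : Ω) * w‖ = ‖w‖ := by rw [norm_mul, hres N hN0, one_mul]
      rw [hsum, norm_neg] at hnorm
      obtain ⟨σ, -, hσ⟩ := IsUltrametricDist.exists_norm_finsetSum_le
        (Finset.univ : Finset Gal(E/M)) (fun σ => (((σ wE : E) : Ω) - w))
      exact absurd (hnorm.symm.le.trans hσ) (not_le.2 (htop σ))
    · obtain ⟨u, hu, hub⟩ : ∃ u ∈ fixedField H, u ∉ (⊥ : IntermediateField M E) := by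
        by_contra! hcon
        exact hbot (le_antisymm hcon bot_le)
      have huM : (u : Ω) ∉ M := fun h => hub (mem_bot.2 ⟨⟨u, h⟩, rfl⟩)
      have huN : (u : Ω) ∈ M⟮v⟯ := by
        have h1 : u ∈ M⟮wE⟯ := by
          rw [← IsGalois.fixedField_fixingSubgroup M⟮wE⟯, mem_fixedField_iff]
          intro σ hσ
          refine (mem_fixedField_iff _ _).1 hu σ ?_
          have : σ wE = wE := (mem_fixingSubgroup_iff _ _).1 hσ wE (mem_adjoin_simple_self M wE)
          rw [hHmem, this]
          change ‖w - w‖ < ‖w‖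
          rwa [sub_self, norm_zero]
        have h2 : (M⟮wE⟯).map E.val = M⟮w⟯ := by
          rw [adjoin_map, Set.image_singleton]
          rfl
        rw [← hwN, ← h2]
        exact ⟨u, h1, rfl⟩
      have hwu : w ∈ M⟮(u : Ω)⟯ := by
        rw [hatom u huN huM, ← hwN]
        exact mem_adjoin_simple_self M w
      have hwEu : wE ∈ M⟮u⟯ := by
        have h2 : (M⟮u⟯).map E.val = M⟮(u : Ω)⟯ := by
          rw [adjoin_map, Set.image_singleton]
          rfl
        rw [← h2] at hwu
        obtain ⟨y, hy, hyw⟩ := hwu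
        have : y = wE := Subtype.ext hyw
        exact this ▸ hy
      have hle : M⟮u⟯ ≤ fixedField H := adjoin_simple_le_iff.2 hu
      exact fun σ hσ => (mem_fixedField_iff _ _).1 (hle hwEu) σ hσ
  have hconj : ∀ b : Ω, aeval b (minpoly M w) = 0 → ∃ σ : Gal(E/M), ((σ wE : E) : Ω) = b := by
    intro b hb
    have hmw : minpoly M w = minpoly M wE := (IntermediateField.minpoly_eq wE).symm
    have hsp := hEn.splits wE
    rw [← hmw] at hsp
    obtain ⟨y, hy⟩ : ∃ y : E, (y : Ω) = b := by
      have hb' : (((minpoly M w).map (algebraMap M E)).map (algebraMap E Ω)).IsRoot b := by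
        rw [Polynomial.map_map, ← IsScalarTower.algebraMap_eq, IsRoot, eval_map]
        exact hb
      obtain ⟨y, hy⟩ := hsp.mem_range_of_isRoot
        (Polynomial.map_ne_zero (minpoly.ne_zero hwa.isIntegral)) hb'
      exact ⟨y, hy⟩
    have hyr : aeval y (minpoly M wE) = 0 := by
      rw [← hmw]
      refine E.val.injective ?_
      change E.val _ = E.val 0
      rw [← aeval_algHom_apply E.val y, map_zero]
      change aeval (y : Ω) _ = 0
      rw [hy]
      exact hb
    have hyw : minpoly M wE = minpoly M y := by
      have hinteg : IsIntegral M wE := Algebra.IsIntegral.isIntegral wE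
      exact minpoly.eq_of_irreducible_of_monic (minpoly.irreducible hinteg) hyr (minpoly.monic hinteg)
    obtain ⟨σ, hσ⟩ := isConjRoot_iff_exists_algEquiv.1 hyw.symm
    exact ⟨σ, by rw [hσ, hy]⟩
  refine ⟨w, hwa, hwM, fun b c hb hc hbc => ?_⟩
  obtain ⟨σ, rfl⟩ := hconj b hb
  obtain ⟨τ, rfl⟩ := hconj c hc
  have h1 : ‖((σ wE : E) : Ω) - ((τ wE : E) : Ω)‖ = ‖(((τ⁻¹ * σ) wE : E) : Ω) - w‖ := by
    rw [show (((τ⁻¹ * σ) wE : E) : Ω) - w = (((τ⁻¹ * σ) wE - wE : E) : Ω) by push_cast; rfl,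
      ← hiso τ, map_sub, ← AlgEquiv.mul_apply, mul_inv_cancel_left]
    push_cast
    rfl
  refine le_antisymm ?_ ?_
  · rw [sub_eq_add_neg]
    refine (IsUltrametricDist.norm_add_le_max _ _).trans ?_
    rw [norm_neg, hiso, hiso, max_self]
  · by_contra! hlt
    rw [h1] at hlt
    have := hH _ hlt
    apply hbc
    rw [AlgEquiv.mul_apply, ← (τ.injective.eq_iff), ← AlgEquiv.mul_apply, mul_inv_cancel,
      AlgEquiv.one_apply] at this
    rw [this]

lemma RelApprox.topologicalClosure {q : ℝ} (hq0 : 0 < q) (hq1 : q < 1) {M L : Subfield Ω}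
    (h : RelApprox q M L) : RelApprox q M.topologicalClosure L := by
  intro a ha
  by_cases ha0 : a = 0
  · exact ⟨0, zero_mem L, by rw [ha0]; exact RelClose.refl hq0.le 0⟩
  · have ha' : 0 < ‖a‖ := norm_pos_iff.2 ha0
    have hcl : a ∈ closure (M : Set Ω) := ha
    obtain ⟨m, hm, ham⟩ := Metric.mem_closure_iff.1 hcl (q * ‖a‖) (by positivity)
    rw [dist_eq_norm] at ham
    have hr : RelClose q a m := ham.le
    obtain ⟨z, hz, hmz⟩ := h m hm
    refine ⟨z, hz, ?_⟩
    rw [RelClose, hr.norm_eq hq1] at hmz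
    rw [RelClose, ← sub_add_sub_cancel a m z]
    exact (IsUltrametricDist.norm_add_le_max _ _).trans (max_le hr hmz)

open IntermediateField in
/-- Relative approximability by a closed, relatively algebraically closed subfield passes to
the closure of the algebraic closure, in residue characteristic zero. -/
lemma RelApprox.exists_le {q : ℝ} (hq0 : 0 < q) (hq1 : q < 1) (hres : ResidueCharZero Ω)
    {M L : Subfield Ω} (hL : ∀ x : Ω, IsAlgebraic L x → x ∈ L) (h : RelApprox q M L) :
    ∃ N : Subfield Ω, M ≤ N ∧ RelApprox q N L ∧ IsClosed (N : Set Ω) ∧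
      ∀ x : Ω, IsAlgebraic N x → x ∈ N := by
  have := hres.charZero
  obtain ⟨N, hMN, hN⟩ := zorn_le_nonempty₀ {N : Subfield Ω | RelApprox q N L} (by
    intro c hc hchain N hN
    refine ⟨sSup c, ?_, fun _ => le_sSup⟩
    intro a ha
    rw [← SetLike.mem_coe, Subfield.coe_sSup_of_directedOn ⟨N, hN⟩ hchain.directedOn] at ha
    obtain ⟨P, hP, haP⟩ := Set.mem_iUnion₂.1 ha
    exact hc hP a haP) M h
  have hNc : IsClosed (N : Set Ω) := by
    rw [hN.eq_of_le (hN.prop.topologicalClosure hq0 hq1) N.le_topologicalClosure]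
    exact N.isClosed_topologicalClosure
  refine ⟨N, hMN, hN.prop, hNc, ?_⟩
  by_contra! hex
  obtain ⟨w, hw, hwN, hd⟩ := exists_conjugates_dist_eq hres hNc hex
  have hw0 : w ≠ 0 := fun h0 => hwN (h0 ▸ zero_mem N)
  have hadj := RelApprox.adjoin_simple hq0.le hq1 hNc hL hN.prop hw0 hw hd
  have hle : N ≤ N⟮w⟯.toSubfield := fun x hx => (N⟮w⟯).algebraMap_mem ⟨x, hx⟩
  apply hwN
  rw [hN.eq_of_le hadj hle]
  exact mem_adjoin_simple_self N w

lemma RelApprox.le_of_le {q : ℝ} (hq1 : q < 1) {M L : Subfield Ω}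
    (hL : IsClosed (L : Set Ω)) (h : RelApprox q M L) (hLM : L ≤ M) : M ≤ L := by
  intro w hw
  have hne : (L : Set Ω).Nonempty := ⟨0, zero_mem L⟩
  rw [← SetLike.mem_coe, hL.mem_iff_infDist_zero hne]
  set d := infDist w (L : Set Ω)
  have hd0 : 0 ≤ d := infDist_nonneg
  have hle : ∀ z ∈ L, d ≤ q * dist w z := by
    intro z hz
    obtain ⟨z', hz', hzz'⟩ := h (w - z) (sub_mem hw (hLM hz))
    have : d ≤ dist w (z + z') := infDist_le_dist_of_mem (add_mem hz hz')
    rw [dist_eq_norm, ← sub_sub] at this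
    rw [dist_eq_norm]
    exact this.trans hzz'
  by_contra hd
  have hdpos : 0 < d := lt_of_le_of_ne hd0 (Ne.symm hd)
  have hqpos : 0 < q := by
    obtain ⟨z, hz⟩ := hne
    by_contra! hq
    have : q * dist w z ≤ 0 := mul_nonpos_of_nonpos_of_nonneg hq dist_nonneg
    linarith [hle z hz]
  have hlt : d < d / q := by
    rw [lt_div_iff₀ hqpos]
    nlinarith
  obtain ⟨z, hz, hwz⟩ := (infDist_lt_iff hne).1 hlt
  rw [lt_div_iff₀ hqpos] at hwz
  have := hle z hz
  linarith [mul_comm q (dist w z)]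

open IntermediateField in
/-- If `x'` is close to `x` relative to its distance to every element of a relatively algebraically
closed field `k`, then every element of `k(x')` is close to an element of `k(x)`. -/
lemma relApprox_adjoin_simple {q : ℝ} (hq0 : 0 ≤ q) (hq1 : q < 1) {k : Subfield Ω}
    (hk : ∀ x : Ω, IsAlgebraic k x → x ∈ k) {x x' : Ω} (h : ∀ a ∈ k, RelClose q (x' - a) (x - a)) :
    RelApprox q k⟮x'⟯.toSubfield k⟮x⟯.toSubfield := by
  have hpoly : ∀ r : Polynomial k, RelClose q (aeval x' r) (aeval x r) := by
    intro r
    by_cases hr : r = 0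
    · rw [hr, map_zero, map_zero]
      exact RelClose.refl hq0 0
    have hmap : r.map k.subtype ≠ 0 := by
      rwa [Ne, Polynomial.map_eq_zero_iff k.subtype.injective]
    have heval : ∀ y : Ω, aeval y r = k.subtype r.leadingCoeff *
        ((r.map k.subtype).roots.map fun b => y - b).prod := by
      intro y
      have h1 : aeval y r = (r.map k.subtype).eval y := by
        rw [eval_map]
        rfl
      rw [h1, (IsAlgClosed.splits (r.map k.subtype)).eval_eq_prod_roots, leadingCoeff_map]
    rw [heval, heval]
    refine (RelClose.refl hq0 _).mul hq1 (RelClose.multiset_prod hq0 hq1 _ fun b hb => h b (hk b ?_))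
    refine ⟨r, hr, ?_⟩
    rw [mem_roots hmap, IsRoot, eval_map] at hb
    exact hb
  intro a ha
  obtain ⟨r, s, rfl⟩ := (mem_adjoin_simple_iff k a).1 ha
  refine ⟨aeval x r / aeval x s, (mem_adjoin_simple_iff k _).2 ⟨r, s, rfl⟩, ?_⟩
  rw [div_eq_mul_inv, div_eq_mul_inv]
  exact (hpoly r).mul hq1 ((hpoly s).inv hq1)

open IntermediateField in
lemma isAlgebraic_adjoin_simple_exchange {k : Subfield Ω} {x y : Ω} (hx : ¬ IsAlgebraic k x)
    (h : IsAlgebraic k⟮y⟯ x) : IsAlgebraic k⟮x⟯ y := by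
  by_cases hy : IsAlgebraic k y
  · exact hy.tower_top _
  · exact isAlgebraic_adjoin_iff.2 (.adjoin_singleton hy hx (isAlgebraic_adjoin_iff.1 h))

open IntermediateField in
lemma mem_topAlgClosure_adjoin_exchange (hres : ResidueCharZero Ω) {k : Subfield Ω}
    (hkc : IsClosed (k : Set Ω)) (hk : ∀ x : Ω, IsAlgebraic k x → x ∈ k) {x y : Ω} (hxk : x ∉ k)
    (hx : x ∈ topAlgClosure k⟮y⟯.toSubfield) : y ∈ topAlgClosure k⟮x⟯.toSubfield := by
  have hne : (k : Set Ω).Nonempty := ⟨0, zero_mem k⟩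
  have hr : 0 < infDist x (k : Set Ω) := (hkc.notMem_iff_infDist_pos hne).1 hxk
  set r := infDist x (k : Set Ω)
  have hxcl : x ∈ closure {z : Ω | IsAlgebraic k⟮y⟯.toSubfield z} := by
    rw [← coe_topAlgClosure]
    exact hx
  obtain ⟨x', hx', hxx'⟩ := Metric.mem_closure_iff.1 hxcl (r / 2) (by positivity)
  rw [dist_eq_norm] at hxx'
  have hfar : ∀ a ∈ k, r ≤ ‖x - a‖ := fun a ha => by
    rw [← dist_eq_norm]
    exact infDist_le_dist_of_mem ha
  have hfar' : ∀ a ∈ k, r ≤ ‖x' - a‖ := by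
    intro a ha
    by_contra! hlt
    have := IsUltrametricDist.norm_add_le_max (x - x') (x' - a)
    rw [sub_add_sub_cancel] at this
    exact absurd ((hfar a ha).trans this) (not_le.2 (max_lt (by linarith) hlt))
  have hclose : ∀ a ∈ k, RelClose (1 / 2) (x' - a) (x - a) := by
    intro a ha
    rw [RelClose, sub_sub_sub_cancel_right, norm_sub_rev]
    linarith [hfar' a ha]
  have hx'k : ¬ IsAlgebraic k x' := fun halg => by
    have := hfar' x' (hk x' halg)
    rw [sub_self, norm_zero] at this
    linarith
  have hy : IsAlgebraic k⟮x'⟯ y := isAlgebraic_adjoin_simple_exchange hx'k hx'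
  set L := topAlgClosure k⟮x⟯.toSubfield with hLdef
  have hLc : IsClosed (L : Set Ω) := isClosed_topAlgClosure _
  have hLa : ∀ z : Ω, IsAlgebraic L z → z ∈ L := fun z hz =>
    mem_topAlgClosure_of_isAlgebraic_topAlgClosure hz
  have hbase : RelApprox (1 / 2) k⟮x'⟯.toSubfield L := fun a ha => by
    obtain ⟨z, hz, haz⟩ := relApprox_adjoin_simple (by norm_num) (by norm_num) hk hclose a ha
    exact ⟨z, le_topAlgClosure _ hz, haz⟩
  obtain ⟨N, hN, hNL, hNc, hNa⟩ := hbase.exists_le (by norm_num) (by norm_num) hres hLa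
  have hkN : k ≤ N := fun a ha => hN ((k⟮x'⟯).algebraMap_mem ⟨a, ha⟩)
  have hyN : y ∈ N := hNa y (IsAlgebraic.of_subfield_le (k := k⟮x'⟯.toSubfield) hN hy)
  have hadj : ∀ z ∈ N, k⟮z⟯.toSubfield ≤ N := by
    intro z hz
    change Subfield.closure _ ≤ N
    rw [Subfield.closure_le]
    rintro _ (⟨a, rfl⟩ | rfl)
    · exact hkN a.2
    · exact hz
  have hxN : x ∈ N := topAlgClosure_le hNc hNa (hadj y hyN) hx
  exact hNL.le_of_le (by norm_num) hLc (topAlgClosure_le hNc hNa (hadj x hxN)) hyN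

namespace ClosureOperator

variable {α : Type*} {c : ClosureOperator (Set α)}

lemma notMem_sdiff_of_subset {S T : Set α} (hST : S ⊆ T) (hT : ∀ x ∈ T, x ∉ c (T \ {x})) :
    ∀ x ∈ S, x ∉ c (S \ {x}) := fun x hx hxc =>
  hT x (hST hx) (c.monotone (Set.sdiff_subset_sdiff_left hST) hxc)

lemma notMem_sdiff_insert (hc : ∀ (S : Set α) (x y : α), x ∉ c S → x ∈ c (insert y S) →
      y ∈ c (insert x S)) {S : Set α} (hS : ∀ x ∈ S, x ∉ c (S \ {x})) {y : α} (hy : y ∉ c S) :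
    ∀ x ∈ insert y S, x ∉ c (insert y S \ {x}) := by
  have hyS : y ∉ S := fun h => hy (c.le_closure S h)
  rintro x (rfl | hx) hxc
  · rw [Set.insert_sdiff_self_of_notMem hyS] at hxc
    exact hy hxc
  · have hxy : y ∉ ({x} : Set α) := fun h => hyS (Set.mem_singleton_iff.1 h ▸ hx)
    rw [Set.insert_sdiff_of_notMem _ hxy] at hxc
    have := hc _ _ _ (hS x hx) hxc
    rw [Set.insert_sdiff_singleton, Set.insert_eq_of_mem hx] at this
    exact hy this

/-- The Steinitz exchange lemma for a closure operator with the exchange property. -/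
lemma card_le_card_of_subset (hc : ∀ (S : Set α) (x y : α), x ∉ c S → x ∈ c (insert y S) →
      y ∈ c (insert x S)) {I J : Finset α} (hI : ∀ x ∈ (I : Set α), x ∉ c ((I : Set α) \ {x}))
    (hIJ : (I : Set α) ⊆ c J) : I.card ≤ J.card := by
  classical
  induction hn : (I \ J).card generalizing I with
  | zero =>
    exact Finset.card_le_card (Finset.sdiff_eq_empty_iff_subset.1 (Finset.card_eq_zero.1 hn))
  | succ n ih =>
    obtain ⟨x, hx⟩ : (I \ J).Nonempty := by
      rw [← Finset.card_pos]
      omega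
    obtain ⟨hxI, hxJ⟩ := Finset.mem_sdiff.1 hx
    obtain ⟨y, hyJ, hy⟩ : ∃ y ∈ J, y ∉ c ((I : Set α) \ {x}) := by
      by_contra! hcon
      have hle : c J ≤ c ((I : Set α) \ {x}) := c.le_closure_iff.1 hcon
      exact hI x hxI (hle (hIJ hxI))
    have hcoe : ((I.erase x : Finset α) : Set α) = (I : Set α) \ {x} := Finset.coe_erase x I
    have hyI : y ∉ I.erase x := fun h => hy (c.le_closure _ (hcoe ▸ Finset.mem_coe.2 h))
    have hcard : (insert y (I.erase x)).card = I.card := by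
      rw [Finset.card_insert_of_notMem hyI, Finset.card_erase_add_one hxI]
    rw [← hcard]
    refine ih ?_ ?_ ?_
    · rw [Finset.coe_insert, hcoe]
      exact notMem_sdiff_insert hc (notMem_sdiff_of_subset Set.sdiff_subset hI) hy
    · rw [Finset.coe_insert, hcoe]
      exact Set.insert_subset (c.le_closure _ hyJ) (Set.sdiff_subset.trans hIJ)
    · rw [Finset.insert_sdiff_of_mem _ hyJ, Finset.erase_sdiff_comm, Finset.card_erase_of_mem hx, hn,
        Nat.add_sub_cancel]

end ClosureOperator

lemma hatGen_le {K l : Subfield Ω} {S : Set Ω} (hl : IsClosed (l : Set Ω)) (hK : K ≤ l)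
    (hS : S ⊆ l) : hatGen K S ≤ l :=
  Subfield.topologicalClosure_minimal _ (Subfield.closure_le.2 (Set.union_subset hK hS)) hl

lemma le_topAlgClosure_hatGen (K : Subfield Ω) (S : Set Ω) : K ≤ topAlgClosure (hatGen K S) :=
  fun _ hx => le_topAlgClosure _ (mem_hatGen_of_mem hx)

lemma subset_topAlgClosure_hatGen (K : Subfield Ω) (S : Set Ω) :
    S ⊆ topAlgClosure (hatGen K S) :=
  fun _ hx => le_topAlgClosure _ (mem_hatGen_of_mem_set hx)

lemma topAlgClosure_hatGen_le {K k : Subfield Ω} {S : Set Ω} (hK : K ≤ topAlgClosure k)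
    (hS : S ⊆ topAlgClosure k) : topAlgClosure (hatGen K S) ≤ topAlgClosure k :=
  topAlgClosure_le (isClosed_topAlgClosure _)
    (fun _ => mem_topAlgClosure_of_isAlgebraic_topAlgClosure)
    (hatGen_le (isClosed_topAlgClosure _) hK hS)

/-- The closure operator sending `S` to the set of elements topgebraic over `hat{K(S)}`. -/
noncomputable def topgebraicClosure (K : Subfield Ω) : ClosureOperator (Set Ω) :=
  .mk₂ (fun S => {x | IsTopgebraicElem (hatGen K S) x})
    (fun S x hx => subset_closure (isAlgebraic_algebraMap
      (⟨x, mem_hatGen_of_mem_set hx⟩ : hatGen K S)))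
    (fun S T h => by
      change closure _ ⊆ closure _
      change S ⊆ closure _ at h
      rw [← coe_topAlgClosure] at h
      rw [← coe_topAlgClosure, ← coe_topAlgClosure]
      exact topAlgClosure_hatGen_le (le_topAlgClosure_hatGen K T) h)

lemma topgebraicClosure_apply (K : Subfield Ω) (S : Set Ω) :
    topgebraicClosure K S = topAlgClosure (hatGen K S) := (coe_topAlgClosure _).symm

open IntermediateField in
lemma topgebraicClosure_exchange (hres : ResidueCharZero Ω) (K : Subfield Ω) (S : Set Ω) (x y : Ω)
    (hx : x ∉ topgebraicClosure K S) (hxy : x ∈ topgebraicClosure K (insert y S)) :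
    y ∈ topgebraicClosure K (insert x S) := by
  rw [topgebraicClosure_apply] at hx hxy ⊢
  set k := topAlgClosure (hatGen K S) with hk
  have hkadj : ∀ z, k ≤ topAlgClosure k⟮z⟯.toSubfield := fun z a ha =>
    le_topAlgClosure _ ((k⟮z⟯).algebraMap_mem ⟨a, ha⟩)
  have hle : topAlgClosure (hatGen K (insert y S)) ≤ topAlgClosure k⟮y⟯.toSubfield :=
    topAlgClosure_hatGen_le ((le_topAlgClosure_hatGen K S).trans (hkadj y))
      (Set.insert_subset (le_topAlgClosure _ (mem_adjoin_simple_self k y))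
        ((subset_topAlgClosure_hatGen K S).trans (hkadj y)))
  have hy := mem_topAlgClosure_adjoin_exchange hres (isClosed_topAlgClosure _)
    (fun _ => mem_topAlgClosure_of_isAlgebraic_topAlgClosure) hx (hle hxy)
  refine topAlgClosure_le (isClosed_topAlgClosure _)
    (fun _ => mem_topAlgClosure_of_isAlgebraic_topAlgClosure) ?_ hy
  change Subfield.closure _ ≤ _
  rw [Subfield.closure_le]
  rintro _ (⟨a, rfl⟩ | rfl)
  · exact topAlgClosure_hatGen_le (le_topAlgClosure_hatGen K _)
      ((Set.subset_insert x S).trans (subset_topAlgClosure_hatGen K _)) a.2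
  · exact subset_topAlgClosure_hatGen K _ (Set.mem_insert _ S)

lemma mk_le_topdeg {K F : Subfield Ω} {S : Set Ω} (hSF : S ⊆ F) (hS : TopgebraicIndep K S) :
    Cardinal.mk S ≤ topdeg K F :=
  le_ciSup (f := fun S : {S : Set Ω // S ⊆ (F : Set Ω) ∧ TopgebraicIndep K S} => Cardinal.mk S.1)
    Cardinal.bddAbove_of_small ⟨S, hSF, hS⟩

lemma mk_le_mk_of_topgebraicallyGenerates (hres : ResidueCharZero Ω) {K F : Subfield Ω}
    {S T : Set Ω} (hfin : Cardinal.mk S < Cardinal.aleph0) (hSF : S ⊆ F)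
    (hS : TopgebraicIndep K S) (hT : TopgebraicallyGenerates K F T) :
    Cardinal.mk S ≤ Cardinal.mk T := by
  rcases lt_or_ge (Cardinal.mk T) Cardinal.aleph0 with hTf | hTi
  · lift S to Finset Ω using Cardinal.lt_aleph0_iff_set_finite.1 hfin
    lift T to Finset Ω using Cardinal.lt_aleph0_iff_set_finite.1 hTf
    change Cardinal.mk {x // x ∈ S} ≤ Cardinal.mk {x // x ∈ T}
    rw [Cardinal.mk_coe_finset, Cardinal.mk_coe_finset, Nat.cast_le]
    exact ClosureOperator.card_le_card_of_subset (topgebraicClosure_exchange hres K) hS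
      (hSF.trans hT)
  · exact hfin.le.trans hTi

lemma exists_maximal_topgebraicIndep {K F : Subfield Ω} (hfin : topdeg K F < Cardinal.aleph0) :
    ∃ S : Set Ω, S ⊆ F ∧ TopgebraicIndep K S ∧
      ∀ S' : Set Ω, S ⊆ S' → S' ⊆ F → TopgebraicIndep K S' → S' = S := by
  obtain ⟨n, hn⟩ := Cardinal.lt_aleph0.1 hfin
  have hncard : ∀ S : Set Ω, S ⊆ F → TopgebraicIndep K S → S.Finite ∧ S.ncard ≤ n := by
    intro S hSF hS
    have hle := mk_le_topdeg hSF hS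
    have hSf := Cardinal.lt_aleph0_iff_set_finite.1 (hle.trans_lt hfin)
    refine ⟨hSf, ?_⟩
    rw [hn, ← Set.cast_ncard hSf, Nat.cast_le] at hle
    exact hle
  obtain ⟨S, ⟨hSF, hS⟩, hmin⟩ := exists_minimalFor_of_wellFoundedLT
    (fun S : Set Ω => S ⊆ F ∧ TopgebraicIndep K S) (fun S => n - S.ncard)
    ⟨∅, Set.empty_subset _, fun x hx => hx.elim⟩
  refine ⟨S, hSF, hS, fun S' hSS' hSF' hS' => ?_⟩
  obtain ⟨hfS', hnS'⟩ := hncard S' hSF' hS'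
  have hmono := Set.ncard_le_ncard hSS' hfS'
  have hle : n - S.ncard ≤ n - S'.ncard :=
    hmin (j := S') ⟨hSF', hS'⟩ (Nat.sub_le_sub_left hmono n)
  exact (Set.eq_of_subset_of_ncard_le hSS' (by omega) hfS').symm

lemma TopgebraicIndep.topgebraicallyGenerates_of_maximal (hres : ResidueCharZero Ω)
    {K F : Subfield Ω} {S : Set Ω} (hSF : S ⊆ F) (hS : TopgebraicIndep K S)
    (hmax : ∀ S' : Set Ω, S ⊆ S' → S' ⊆ F → TopgebraicIndep K S' → S' = S) :
    TopgebraicallyGenerates K F S := by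
  intro f hf
  by_contra hfS
  have hind : TopgebraicIndep K (insert f S) :=
    ClosureOperator.notMem_sdiff_insert (topgebraicClosure_exchange hres K) hS hfS
  have heq := hmax _ (Set.subset_insert f S) (Set.insert_subset hf hSF) hind
  exact hfS ((topgebraicClosure K).le_closure S (heq ▸ Set.mem_insert f S))

lemma TopgebraicallyGenerates.topgebraicIndep_of_minimal {K F : Subfield Ω} {T : Set Ω}
    (hT : TopgebraicallyGenerates K F T)
    (hmin : ∀ T' : Set Ω, T' ⊆ T → TopgebraicallyGenerates K F T' → T' = T) :
    TopgebraicIndep K T := by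
  intro x hx hxc
  have hsub : T ⊆ topgebraicClosure K (T \ {x}) := by
    intro z hz
    by_cases hzx : z = x
    · rw [hzx]
      exact hxc
    · exact (topgebraicClosure K).le_closure _ ⟨hz, hzx⟩
  have hle : topgebraicClosure K T ≤ topgebraicClosure K (T \ {x}) :=
    (topgebraicClosure K).le_closure_iff.1 hsub
  have heq := hmin (T \ {x}) Set.sdiff_subset (hT.trans hle)
  rw [← heq] at hx
  exact hx.2 rfl

/-- Theorem 4.3.3(i): for an extension `F/K` of analytic fields of residue
characteristic zero with `topdeg(F/K)` finite, one has `topdeg(F/K) = Topdeg(F/K)`, every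
maximal topgebraically independent subset and every minimal topgebraically generating subset
has cardinality `topdeg(F/K)`, and any such subset is a topological transcendence basis. -/
theorem residue_char_zero_topdeg (K F : Subfield Ω)
    (hKc : IsClosed (K : Set Ω)) (hFc : IsClosed (F : Set Ω)) (hKF : K ≤ F)
    (hres : ResidueCharZero Ω)
    (hfin : topdeg K F < Cardinal.aleph0) :
    topdeg K F = Topdeg K F ∧
    (∀ S : Set Ω, S ⊆ (F : Set Ω) → TopgebraicIndep K S →
      (∀ S' : Set Ω, S ⊆ S' → S' ⊆ (F : Set Ω) → TopgebraicIndep K S' → S' = S) →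
      Cardinal.mk S = topdeg K F ∧ TopgebraicallyGenerates K F S) ∧
    (∀ T : Set Ω, T ⊆ (F : Set Ω) → TopgebraicallyGenerates K F T →
      (∀ T' : Set Ω, T' ⊆ T → TopgebraicallyGenerates K F T' → T' = T) →
      Cardinal.mk T = topdeg K F ∧ TopgebraicIndep K T) := by
  have hdeg : ∀ S : Set Ω, S ⊆ (F : Set Ω) → TopgebraicIndep K S →
      TopgebraicallyGenerates K F S → Cardinal.mk S = topdeg K F := fun S hSF hS hSg =>
    le_antisymm (mk_le_topdeg hSF hS) (ciSup_le' fun S' =>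
      mk_le_mk_of_topgebraicallyGenerates hres ((mk_le_topdeg S'.2.1 S'.2.2).trans_lt hfin)
        S'.2.1 S'.2.2 hSg)
  obtain ⟨B, hBF, hB, hBmax⟩ := exists_maximal_topgebraicIndep hfin
  have hBg := hB.topgebraicallyGenerates_of_maximal hres hBF hBmax
  have hBdeg := hdeg B hBF hB hBg
  refine ⟨le_antisymm ?_ ?_, fun S hSF hS hmax => ?_, fun T hTF hT hmin => ?_⟩
  · have : Nonempty {S : Set Ω // S ⊆ (F : Set Ω) ∧ TopgebraicallyGenerates K F S} :=
      ⟨⟨B, hBF, hBg⟩⟩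
    rw [← hBdeg]
    exact le_ciInf fun T =>
      mk_le_mk_of_topgebraicallyGenerates hres (hBdeg.trans_lt hfin) hBF hB T.2.2
  · rw [← hBdeg]
    exact ciInf_le' (fun S : {S : Set Ω // S ⊆ (F : Set Ω) ∧ TopgebraicallyGenerates K F S} =>
      Cardinal.mk S.1) ⟨B, hBF, hBg⟩
  · have hSg := hS.topgebraicallyGenerates_of_maximal hres hSF hmax
    exact ⟨hdeg S hSF hS hSg, hSg⟩
  · have hTi := hT.topgebraicIndep_of_minimal hmin
    exact ⟨hdeg T hTF hTi hT, hTi⟩
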